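/- Let ε > 0 and let F : (−ε,ε) → ℂ be C^∞. Suppose there are a finite set Λ ⊂ ℂ × ℤ_{≥0} and real-analytic functions f_{λ,j} : (−ε,ε) → ℂ for (λ,j) ∈ Λ such that F(x) = Σ_{(λ,j)∈Λ} x^λ (log x)^j f_{λ,j}(x) for all x ∈ (0,ε). Then the restriction of F to (0,ε) extends to a real-analytic function on (−ε,ε); that is, there exists a real-analytic F₁ : (−ε,ε) → ℂ with F₁(x) = F(x) for all x ∈ (0,ε). -/

import Mathlib

set_option autoImplicit false

open Set

open Filter Topology Asymptotics Polynomial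

/-- The real-parameter exponentials `h ↦ exp (μ h)` determine `μ`. -/
theorem eq_of_forall_exp_mul_ofReal_eq {μ ν : ℂ}
    (h : ∀ t : ℝ, Complex.exp (μ * t) = Complex.exp (ν * t)) : μ = ν := by
  have key : ∀ μ : ℂ, HasDerivAt (fun t : ℝ => Complex.exp (μ * t)) μ 0 := by
    intro μ
    have h1 : HasDerivAt (fun z : ℂ => Complex.exp (μ * z)) μ ((0 : ℝ) : ℂ) := by
      simpa using ((hasDerivAt_id (((0 : ℝ) : ℂ))).const_mul μ).cexp
    exact h1.comp_ofReal
  exact (key μ).unique ((funext h : (fun t : ℝ => Complex.exp (μ * t)) = _) ▸ key ν)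

theorem Polynomial.eq_C_of_forall_taylor_ofReal_eq {P : ℂ[X]}
    (h : ∀ t : ℝ, taylor (t : ℂ) P = P) : P = C (P.eval 0) := by
  refine P.eq_of_infinite_eval_eq _ ((Set.infinite_range_of_injective
    Complex.ofReal_injective).mono ?_)
  rintro _ ⟨t, rfl⟩
  have := congrArg (Polynomial.eval 0) (h t)
  simpa [taylor_eval] using this

/-- An exponential polynomial with exponents of real part at most `r` which is `o(exp (r t))` at
`-∞` is trivial. -/
theorem exponential_polynomial_eq_zero_of_isLittleO (T : Finset ℂ) (r : ℝ)
    (hr : ∀ μ ∈ T, μ.re ≤ r) (P : ℂ → ℂ[X])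
    (h : (fun t : ℝ => ∑ μ ∈ T, Complex.exp (μ * t) * (P μ).eval (t : ℂ))
      =o[atBot] fun t => Real.exp (r * t)) :
    ∀ μ ∈ T, P μ = 0 := by
  obtain ⟨d, hd⟩ : ∃ d : ℂ → ℕ, ∀ μ ∈ T, (P μ).degree < d μ :=
    ⟨fun μ => (P μ).natDegree + 1, fun μ _ => by
      exact degree_le_natDegree.trans_lt (by exact_mod_cast Nat.lt_succ_self _)⟩
  induction hn : ∑ μ ∈ T, d μ using Nat.strong_induction_on generalizing d P with
  | _ n ih =>
  by_cases h0 : ∀ μ ∈ T, d μ = 0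
  · intro μ hμ
    have := hd μ hμ
    rw [h0 μ hμ] at this
    by_contra hP
    rw [degree_eq_natDegree hP] at this
    exact absurd this (by simp)
  push Not at h0
  obtain ⟨ν, hν, hdν⟩ := h0
  let Q : ℝ → ℂ → ℂ[X] := fun s μ =>
    C (Complex.exp (μ * s)) * taylor (s : ℂ) (P μ) - C (Complex.exp (ν * s)) * P μ
  have hQ : ∀ s, ∀ μ ∈ T, Q s μ = 0 := by
    intro s
    refine ih (∑ μ ∈ T, Function.update d ν (d ν - 1) μ) ?_ (Q s) ?_
      (Function.update d ν (d ν - 1)) ?_ rfl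
    · rw [← hn]
      refine Finset.sum_lt_sum (fun μ _ => ?_) ⟨ν, hν, by simp; omega⟩
      by_cases hμ : μ = ν
      · subst hμ; simp
      · simp [hμ]
    · have hshift : Tendsto (fun t : ℝ => t + s) atBot atBot :=
        tendsto_atBot_add_const_right _ _ tendsto_id
      have h1 := h.comp_tendsto hshift
      have h2 : (fun t : ℝ => Real.exp (r * (t + s))) =O[atBot] fun t => Real.exp (r * t) := by
        refine IsBigO.of_bound (Real.exp (r * s)) (Eventually.of_forall fun t => ?_)
        rw [Real.norm_of_nonneg (Real.exp_pos _).le, Real.norm_of_nonneg (Real.exp_pos _).le,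
          ← Real.exp_add]
        exact le_of_eq (by ring_nf)
      refine ((h1.trans_isBigO h2).sub (h.const_mul_left (Complex.exp (ν * s)))).congr_left
        fun t => ?_
      simp only [Function.comp_apply, Finset.mul_sum, ← Finset.sum_sub_distrib]
      refine Finset.sum_congr rfl fun μ _ => ?_
      simp only [Q, eval_sub, eval_mul, eval_C, taylor_eval, Complex.ofReal_add, mul_add,
        Complex.exp_add]
      ring
    · intro μ hμ
      by_cases hμν : μ = ν
      · subst hμν
        by_cases hP : P μ = 0
        · simp [Q, hP]
        have e : Q s μ = C (Complex.exp (μ * s)) * (taylor (s : ℂ) (P μ) - P μ) := by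
          simp [Q, mul_sub]
        have h1 : (taylor (s : ℂ) (P μ) - P μ).degree < (P μ).degree := by
          have := degree_sub_lt_left (p := taylor (s : ℂ) (P μ)) (q := P μ) (degree_taylor _ _)
            (by simpa using hP) (leadingCoeff_taylor _ _)
          rwa [degree_taylor] at this
        have h2 := hd μ hμ
        rw [degree_eq_natDegree hP] at h1 h2
        rw [e, degree_C_mul (Complex.exp_ne_zero _)]
        refine h1.trans_le ?_
        have h3 : (P μ).natDegree < d μ := by exact_mod_cast h2
        simp only [Function.update_self]
        exact_mod_cast (by omega : (P μ).natDegree ≤ d μ - 1)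
      · simp only [Function.update_of_ne hμν]
        refine (degree_sub_le _ _).trans_lt (max_lt ?_ ?_)
        · rw [degree_C_mul (Complex.exp_ne_zero _), degree_taylor]; exact hd μ hμ
        · rw [degree_C_mul (Complex.exp_ne_zero _)]; exact hd μ hμ
  have hne : ∀ μ ∈ T, μ ≠ ν → P μ = 0 := by
    intro μ hμ hμν
    by_contra hP
    refine hμν (eq_of_forall_exp_mul_ofReal_eq fun s => ?_)
    have h1 := congrArg leadingCoeff (sub_eq_zero.mp (hQ s μ hμ))
    simp only [leadingCoeff_mul, leadingCoeff_C, leadingCoeff_taylor] at h1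
    exact mul_right_cancel₀ (leadingCoeff_ne_zero.mpr hP) h1
  have hconst : P ν = C ((P ν).eval 0) := by
    refine eq_C_of_forall_taylor_ofReal_eq fun s => ?_
    refine mul_left_cancel₀ ?_ (sub_eq_zero.mp (hQ s ν hν))
    simp
  have hzero : (P ν).eval 0 = 0 := by
    have h1 : (fun t : ℝ => Complex.exp (ν * t) * (P ν).eval 0)
        =o[atBot] fun t => Real.exp (r * t) := by
      refine h.congr_left fun t => ?_
      rw [Finset.sum_eq_single ν (fun μ hμ hμν => by simp [hne μ hμ hμν])
        (fun h => absurd hν h), hconst]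
      simp
    by_contra hc
    have h2 : (fun t : ℝ => Real.exp (r * t)) =O[atBot]
        fun t : ℝ => Complex.exp (ν * t) * (P ν).eval 0 := by
      refine IsBigO.of_bound (‖(P ν).eval 0‖⁻¹) ?_
      filter_upwards [eventually_le_atBot 0] with t ht
      rw [norm_mul, mul_comm ‖Complex.exp _‖, inv_mul_cancel_left₀ (norm_ne_zero_iff.mpr hc),
        Complex.norm_exp, Real.norm_of_nonneg (Real.exp_pos _).le]
      refine Real.exp_le_exp.mpr ?_
      simpa using mul_le_mul_of_nonpos_right (hr ν hν) ht
    have h3 := h2.trans_isLittleO h1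
    exact isLittleO_irrefl
      (Eventually.of_forall fun t : ℝ => (Real.exp_pos (r * t)).ne').frequently h3
  intro μ hμ
  by_cases hμν : μ = ν
  · rw [hμν, hconst, hzero, C_0]
  · exact hne μ hμ hμν

/-- Linear independence of the functions `x ^ λ * (log x) ^ j` modulo `o(x ^ r)` at `0⁺`, for
`re λ ≤ r`. -/
theorem coeff_eq_zero_of_sum_cpow_mul_log_pow_isLittleO (S : Finset (ℂ × ℕ)) (r : ℝ)
    (hr : ∀ p ∈ S, p.1.re ≤ r) (c : ℂ × ℕ → ℂ)
    (h : (fun x : ℝ => ∑ p ∈ S, (x : ℂ) ^ p.1 * (Real.log x : ℂ) ^ p.2 * c p)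
      =o[𝓝[>] 0] fun x => x ^ r) :
    ∀ p ∈ S, c p = 0 := by
  classical
  let P : ℂ → ℂ[X] := fun μ => ∑ p ∈ S with p.1 = μ, C (c p) * X ^ p.2
  have hP : ∀ μ ∈ S.image Prod.fst, P μ = 0 := by
    refine exponential_polynomial_eq_zero_of_isLittleO _ r (by simpa using hr) P ?_
    refine (h.comp_tendsto Real.tendsto_exp_atBot_nhdsGT).congr (fun t => ?_) (fun t => ?_)
    · simp only [Function.comp_apply, Real.log_exp]
      rw [← Finset.sum_fiberwise_of_maps_to (g := Prod.fst) (t := S.image Prod.fst)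
        (fun p hp => Finset.mem_image_of_mem _ hp)]
      refine Finset.sum_congr rfl fun μ _ => ?_
      simp only [P, eval_finsetSum, Finset.mul_sum]
      refine Finset.sum_congr rfl fun p hp => ?_
      rw [(Finset.mem_filter.mp hp).2, Complex.cpow_def_of_ne_zero (by simp),
        ← Complex.ofReal_log (Real.exp_pos t).le, Real.log_exp]
      simp only [eval_mul, eval_C, eval_pow, eval_X, mul_comm μ]
      ring
    · simp only [Function.comp_apply]
      rw [Real.rpow_def_of_pos (Real.exp_pos t), Real.log_exp, mul_comm]
  intro p hp
  have h1 := congrArg (fun Q : ℂ[X] => Q.coeff p.2)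
    (hP p.1 (Finset.mem_image_of_mem _ hp))
  simp only [P, finsetSum_coeff, coeff_C_mul, coeff_X_pow, coeff_zero] at h1
  rw [Finset.sum_eq_single p] at h1
  · simpa using h1
  · intro q hq hqp
    have : p.2 ≠ q.2 := fun h2 => hqp (Prod.ext (Finset.mem_filter.mp hq).2 h2.symm)
    simp [this]
  · simp [hp]

theorem AnalyticAt.dslope_self {E : Type*} [NormedAddCommGroup E] [NormedSpace ℝ E]
    {g : ℝ → E} {a : ℝ} (hg : AnalyticAt ℝ g a) : AnalyticAt ℝ (dslope g a) a :=
  let ⟨_, hp⟩ := hg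
  ⟨_, hp.has_fpower_series_dslope_fslope⟩

theorem AnalyticOnNhd.dslope {E : Type*} [NormedAddCommGroup E] [NormedSpace ℝ E]
    {g : ℝ → E} {s : Set ℝ} {a : ℝ} (hg : AnalyticOnNhd ℝ g s) :
    AnalyticOnNhd ℝ (dslope g a) s := by
  intro x hx
  by_cases hxa : x = a
  · exact hxa ▸ (hg x hx).dslope_self
  · refine AnalyticAt.congr ?_ (dslope_eventuallyEq_slope_of_ne g hxa).symm
    simp only [slope_fun_def]
    refine AnalyticAt.smul (AnalyticAt.inv (by fun_prop) (sub_ne_zero.mpr hxa)) ?_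
    exact (hg x hx).sub analyticAt_const

theorem cpow_mul_log_pow_mul_self_isLittleO {r : ℝ} (hr : r < 1) {p : ℂ × ℕ} (hp : 0 ≤ p.1.re) :
    (fun x : ℝ => (x : ℂ) ^ p.1 * (Real.log x : ℂ) ^ p.2 * x) =o[𝓝[>] 0] fun x => x ^ r := by
  have hlog := isLittleO_abs_log_rpow_rpow_nhdsGT_zero (s := r - 1) p.2 (by linarith)
  have h1 : (fun x : ℝ => x ^ (p.1.re + 1)) =O[𝓝[>] 0] fun x => x := by
    refine IsBigO.of_bound 1 ?_
    filter_upwards [Ioo_mem_nhdsGT (zero_lt_one (α := ℝ))] with x hx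
    rw [Real.norm_of_nonneg (Real.rpow_nonneg hx.1.le _), Real.norm_of_nonneg hx.1.le, one_mul]
    simpa using Real.rpow_le_rpow_of_exponent_ge hx.1 hx.2.le
      (by linarith : (1 : ℝ) ≤ p.1.re + 1)
  refine ((h1.mul_isLittleO hlog).congr' ?_ ?_).of_norm_left
  · filter_upwards [self_mem_nhdsWithin] with x hx
    have hx : 0 < x := hx
    rw [norm_mul, norm_mul, norm_pow, Complex.norm_cpow_eq_rpow_re_of_pos hx,
      Complex.norm_real, Complex.norm_real, Real.norm_of_nonneg hx.le, Real.norm_eq_abs,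
      Real.rpow_natCast, Real.rpow_add_one hx.ne']
    ring
  · filter_upwards [self_mem_nhdsWithin] with x hx
    have hx : 0 < x := hx
    rw [Real.rpow_sub_one hx.ne']
    field_simp

/-- If a function with an asymptotic power series at `0⁺` is a combination of the
`x ^ λ * (log x) ^ j` with `0 ≤ re λ < 1` and analytic coefficients, then every coefficient other
than that of `1` vanishes to infinite order. -/
theorem le_analyticOrderAt_of_cpow_mul_log_pow_expansion (S : Finset (ℂ × ℕ))
    (h0 : (0, 0) ∈ S) (hS : ∀ p ∈ S, 0 ≤ p.1.re ∧ p.1.re < 1) (n : ℕ) (H : ℝ → ℂ) (a : ℕ → ℂ)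
    (hH : ∀ n, (fun x : ℝ => H x - ∑ k ∈ Finset.range n, a k * (x : ℂ) ^ k)
      =O[𝓝[>] 0] fun x => x ^ n)
    (g : ℂ × ℕ → ℝ → ℂ) (hg : ∀ p ∈ S, AnalyticAt ℝ (g p) 0)
    (hrep : ∀ᶠ x : ℝ in 𝓝[>] 0,
      H x = ∑ p ∈ S, (x : ℂ) ^ p.1 * (Real.log x : ℂ) ^ p.2 * g p x) :
    ∀ p ∈ S, p ≠ (0, 0) → (n : ℕ∞) ≤ analyticOrderAt (g p) 0 := by
  induction n generalizing H a g with
  | zero => simp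
  | succ n ih =>
  obtain ⟨q, hq, hmax⟩ := S.exists_max_image (fun p => p.1.re) ⟨_, h0⟩
  set r := q.1.re
  have hr1 : r < 1 := (hS q hq).2
  have hsum : ∀ x : ℝ, ∑ p ∈ S, (x : ℂ) ^ p.1 * (Real.log x : ℂ) ^ p.2 *
      (if p = (0, 0) then a 0 else 0) = a 0 := by
    intro x
    rw [Finset.sum_eq_single (0, 0) (fun p _ hp => by simp [hp]) (fun h => absurd h0 h)]
    simp
  have hc : ∀ p ∈ S, g p 0 - (if p = (0, 0) then a 0 else 0) = 0 := by
    refine coeff_eq_zero_of_sum_cpow_mul_log_pow_isLittleO S r hmax _ ?_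
    have h1 : (fun x : ℝ => H x - a 0) =o[𝓝[>] 0] fun x => x ^ r := by
      refine (by simpa using hH 1 : (fun x : ℝ => H x - a 0) =O[𝓝[>] 0] fun x => x)
        |>.trans_isLittleO ?_
      refine ((cpow_mul_log_pow_mul_self_isLittleO hr1 (p := (0, 0)) le_rfl).congr_left
        (f₂ := fun x : ℝ => (x : ℂ)) (by simp)).norm_left.congr' ?_ EventuallyEq.rfl
      filter_upwards [self_mem_nhdsWithin] with x hx
      simp [abs_of_pos (show 0 < x from hx)]
    have h2 : (fun x : ℝ => ∑ p ∈ S, (x : ℂ) ^ p.1 * (Real.log x : ℂ) ^ p.2 *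
        (g p x - g p 0)) =o[𝓝[>] 0] fun x => x ^ r := by
      refine IsLittleO.fun_sum (F' := ℝ) fun p hp => ?_
      have h3 : (fun x => g p x - g p 0) =O[𝓝[>] 0] fun x : ℝ => (x : ℂ) := by
        refine ((hg p hp).differentiableAt.isBigO_sub.mono nhdsWithin_le_nhds).trans ?_
        exact IsBigO.of_bound 1 (Eventually.of_forall fun x => by simp)
      exact ((isBigO_refl _ _).mul h3).trans_isLittleO
        (cpow_mul_log_pow_mul_self_isLittleO hr1 (hS p hp).1)
    refine (h1.sub h2).congr' ?_ EventuallyEq.rfl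
    filter_upwards [hrep] with x hx
    simp only [mul_sub, Finset.sum_sub_distrib, hsum, hx]
    ring
  intro p hp hp0
  have hord := ih (fun x => (H x - a 0) / x) (fun k => a (k + 1)) ?_
    (fun p => dslope (g p) 0) (fun p hp => (hg p hp).dslope_self) ?_ p hp hp0
  · have hgp : g p 0 = 0 := by simpa [hp0] using hc p hp
    have e : g p = (id : ℝ → ℝ) • dslope (g p) 0 := by
      ext x
      simpa using (sub_smul_dslope_of_zero hgp x).symm
    rw [e, analyticOrderAt_smul analyticAt_id (hg p hp).dslope_self, analyticOrderAt_id,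
      Nat.cast_succ, add_comm]
    gcongr
  · intro m
    have h2 : (fun x : ℝ => (x : ℂ)⁻¹) =O[𝓝[>] 0] fun x : ℝ => x⁻¹ :=
      IsBigO.of_bound 1 (Eventually.of_forall fun x => by simp)
    refine ((hH (m + 1)).mul h2).congr' ?_ ?_
    · filter_upwards [self_mem_nhdsWithin] with x hx
      have hx' : (x : ℂ) ≠ 0 := by exact_mod_cast (show 0 < x from hx).ne'
      rw [Finset.sum_range_succ']
      simp only [pow_succ, ← mul_assoc, ← Finset.sum_mul]
      field_simp
      ring
    · filter_upwards [self_mem_nhdsWithin] with x hx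
      rw [pow_succ, mul_inv_cancel_right₀ (show 0 < x from hx).ne']
  · filter_upwards [hrep, self_mem_nhdsWithin] with x hx hx0
    have hx' : (x : ℂ) ≠ 0 := by exact_mod_cast (show 0 < x from hx0).ne'
    rw [div_eq_iff hx', hx, ← hsum x, ← Finset.sum_sub_distrib, Finset.sum_mul]
    refine Finset.sum_congr rfl fun p hp => ?_
    have h1 := sub_smul_dslope (g p) 0 x
    rw [sub_zero, Complex.real_smul] at h1
    have h2 := sub_eq_zero.mp (hc p hp)
    rw [← h2]
    linear_combination (-(x : ℂ) ^ p.1 * (Real.log x : ℂ) ^ p.2) * h1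

theorem ContDiffOn.exists_isBigO_sub_sum_pow {b : ℝ} (hb : 0 < b) {H : ℝ → ℂ}
    (hH : ContDiffOn ℝ (⊤ : ℕ∞) H (Icc 0 b)) :
    ∃ a : ℕ → ℂ, ∀ n, (fun x : ℝ => H x - ∑ k ∈ Finset.range n, a k * (x : ℂ) ^ k)
      =O[𝓝[>] 0] fun x => x ^ n := by
  refine ⟨fun k => (k.factorial : ℂ)⁻¹ * iteratedDerivWithin k H (Icc 0 b) 0, fun n => ?_⟩
  have hmem : ∀ᶠ x in 𝓝[>] (0 : ℝ), x ∈ Icc 0 b := Icc_mem_nhdsGT hb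
  cases n with
  | zero =>
    obtain ⟨C, hC⟩ := isCompact_Icc.exists_bound_of_continuousOn hH.continuousOn
    refine IsBigO.of_bound C ?_
    filter_upwards [hmem] with x hx
    simpa using hC x hx
  | succ n =>
    obtain ⟨C, hC⟩ := exists_taylor_mean_remainder_bound (n := n) hb.le
      (hH.of_le (by exact_mod_cast le_top))
    refine IsBigO.of_bound C ?_
    filter_upwards [hmem] with x hx
    have h1 := hC x hx
    rw [taylor_within_apply] at h1
    simp only [sub_zero] at h1
    rw [Real.norm_of_nonneg (pow_nonneg hx.1 _)]
    refine le_of_eq_of_le (congrArg (fun z => ‖H x - z‖) ?_) h1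
    refine Finset.sum_congr rfl fun k _ => ?_
    rw [Complex.real_smul]
    push_cast
    ring

/-- An analytic function agreeing with `x ^ N * F x` for `F` continuous at `0` is divisible by
`x ^ N`. -/
theorem AnalyticOnNhd.exists_eq_of_eq_pow_mul {s : Set ℝ} (h0 : (0 : ℝ) ∈ s) (N : ℕ) {F G : ℝ → ℂ}
    {ε : ℝ} (hε : 0 < ε) (hF : ContinuousAt F 0) (hG : AnalyticOnNhd ℝ G s)
    (h : ∀ x ∈ Ioo 0 ε, G x = (x : ℂ) ^ N * F x) :
    ∃ F₁ : ℝ → ℂ, AnalyticOnNhd ℝ F₁ s ∧ ∀ x ∈ Ioo 0 ε, F₁ x = F x := by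
  induction N generalizing G with
  | zero => exact ⟨G, hG, by simpa using h⟩
  | succ N ih =>
    refine ih (hG.dslope (a := 0)) fun x hx => ?_
    have hG0 : G 0 = 0 := by
      have h1 : Tendsto G (𝓝[>] 0) (𝓝 (G 0)) :=
        (hG 0 h0).continuousAt.tendsto.mono_left nhdsWithin_le_nhds
      have h2 : Tendsto (fun x : ℝ => (x : ℂ) ^ (N + 1) * F x) (𝓝[>] 0) (𝓝 0) := by
        have h3 : ContinuousAt (fun x : ℝ => (x : ℂ) ^ (N + 1) * F x) 0 := by fun_prop
        simpa using h3.tendsto.mono_left (nhdsWithin_le_nhds (s := Ioi 0))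
      refine tendsto_nhds_unique (h1.congr' ?_) h2
      filter_upwards [Ioo_mem_nhdsGT hε] with x hx using h x hx
    have hx' : (x : ℂ) ≠ 0 := by exact_mod_cast hx.1.ne'
    have h1 := sub_smul_dslope_of_zero hG0 x
    rw [sub_zero, Complex.real_smul, h x hx] at h1
    refine mul_left_cancel₀ hx' (h1.trans (by ring))

/-- If a `C^∞` function on `(-ε,ε)` admits an expansion
`F(x) = Σ_{(λ,j)∈Λ} x^λ (log x)^j f_{λ,j}(x)` on `(0,ε)` with analytic coefficient functions,
then `F|_{(0,ε)}` extends to a real-analytic function on `(-ε,ε)`. -/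
theorem smooth_log_pow_expansion_extends_analytically
    (ε : ℝ) (hε : 0 < ε) (F : ℝ → ℂ)
    (hF : ContDiffOn ℝ (⊤ : ℕ∞) F (Ioo (-ε) ε))
    (Λ : Finset (ℂ × ℕ)) (f : ℂ × ℕ → ℝ → ℂ)
    (hfa : ∀ p ∈ Λ, AnalyticOnNhd ℝ (f p) (Ioo (-ε) ε))
    (hrep : ∀ x ∈ Ioo (0 : ℝ) ε,
      F x = ∑ p ∈ Λ, (x : ℂ) ^ p.1 * (Real.log x : ℂ) ^ p.2 * f p x) :
    ∃ F₁ : ℝ → ℂ, AnalyticOnNhd ℝ F₁ (Ioo (-ε) ε) ∧ ∀ x ∈ Ioo (0 : ℝ) ε, F₁ x = F x := by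
  classical
  have h0ε : (0 : ℝ) ∈ Ioo (-ε) ε := ⟨by linarith, hε⟩
  obtain ⟨N, hN⟩ : ∃ N : ℕ, ∀ p ∈ Λ, 0 ≤ ⌊p.1.re⌋ + N := by
    refine ⟨Λ.sup fun p => (-⌊p.1.re⌋).toNat, fun p hp => ?_⟩
    have := Finset.le_sup (f := fun p : ℂ × ℕ => (-⌊p.1.re⌋).toNat) hp
    omega
  let red : ℂ × ℕ → ℂ × ℕ := fun p => (p.1 - ⌊p.1.re⌋, p.2)
  let k : ℂ × ℕ → ℕ := fun p => (⌊p.1.re⌋ + N).toNat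
  let S : Finset (ℂ × ℕ) := insert (0, 0) (Λ.image red)
  let g : ℂ × ℕ → ℝ → ℂ := fun q x => ∑ p ∈ Λ with red p = q, (x : ℂ) ^ k p * f p x
  have hS : ∀ p ∈ S, 0 ≤ p.1.re ∧ p.1.re < 1 := by
    intro p hp
    rcases Finset.mem_insert.mp hp with rfl | hp
    · simp
    · obtain ⟨p, -, rfl⟩ := Finset.mem_image.mp hp
      simp only [red, Complex.sub_re, Complex.intCast_re]
      exact ⟨Int.fract_nonneg _, Int.fract_lt_one _⟩
  have hg : ∀ q, AnalyticOnNhd ℝ (g q) (Ioo (-ε) ε) := by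
    intro q x hx
    refine Finset.analyticAt_fun_sum _ fun p hp => ?_
    exact ((Complex.ofRealCLM.analyticAt x).pow _).mul (hfa p (Finset.mem_filter.mp hp).1 x hx)
  have hexp : ∀ x ∈ Ioo (0 : ℝ) ε, (x : ℂ) ^ N * F x =
      ∑ q ∈ S, (x : ℂ) ^ q.1 * (Real.log x : ℂ) ^ q.2 * g q x := by
    intro x hx
    have hx' : (x : ℂ) ≠ 0 := by exact_mod_cast hx.1.ne'
    rw [hrep x hx, Finset.mul_sum, ← Finset.sum_fiberwise_of_maps_to (g := red) (t := S)
      (fun p hp => Finset.mem_insert_of_mem (Finset.mem_image_of_mem _ hp))]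
    refine Finset.sum_congr rfl fun q _ => ?_
    simp only [g, Finset.mul_sum]
    refine Finset.sum_congr rfl fun p hp => ?_
    obtain ⟨hpΛ, rfl⟩ := Finset.mem_filter.mp hp
    have h1 : (x : ℂ) ^ N * (x : ℂ) ^ p.1 = (x : ℂ) ^ (red p).1 * (x : ℂ) ^ k p := by
      rw [← Complex.cpow_natCast, ← Complex.cpow_natCast, ← Complex.cpow_add _ _ hx',
        ← Complex.cpow_add _ _ hx']
      congr 1
      have h2 : ((k p : ℤ) : ℂ) = ((⌊p.1.re⌋ + N : ℤ) : ℂ) := by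
        rw [Int.toNat_of_nonneg (hN p hpΛ)]
      push_cast at h2
      simp only [red, h2]
      ring
    linear_combination ((Real.log x : ℂ) ^ p.2 * f p x) * h1
  have hsmooth : ContDiffOn ℝ (⊤ : ℕ∞) (fun x : ℝ => (x : ℂ) ^ N * F x) (Icc 0 (ε / 2)) :=
    ((Complex.ofRealCLM.contDiff.pow N).contDiffOn.mul hF).mono
      fun x hx => ⟨by linarith [hx.1], by linarith [hx.2]⟩
  obtain ⟨a, ha⟩ := hsmooth.exists_isBigO_sub_sum_pow (half_pos hε)
  have hzero : ∀ q ∈ S, q ≠ (0, 0) → EqOn (g q) 0 (Ioo (-ε) ε) := by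
    intro q hq hq0
    refine (hg q).eqOn_zero_of_preconnected_of_eventuallyEq_zero isPreconnected_Ioo h0ε ?_
    refine analyticOrderAt_eq_top.mp (ENat.eq_top_iff_forall_ge.mpr fun n => ?_)
    exact le_analyticOrderAt_of_cpow_mul_log_pow_expansion S (Finset.mem_insert_self _ _) hS n
      _ a ha g (fun p _ => hg p 0 h0ε)
      (by filter_upwards [Ioo_mem_nhdsGT hε] with x hx using hexp x hx) q hq hq0
  refine (hg (0, 0)).exists_eq_of_eq_pow_mul h0ε N hε
    (hF.continuousOn.continuousAt (Ioo_mem_nhds h0ε.1 h0ε.2)) fun x hx => ?_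
  rw [hexp x hx, Finset.sum_eq_single (0, 0) _ (fun h => absurd (Finset.mem_insert_self _ _) h)]
  · simp
  · intro q hq hq0
    rw [hzero q hq hq0 ⟨by linarith [hx.1], hx.2⟩]
    simp
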